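/- Assume (f_i)_{i=1}^N satisfies the open set condition. Then the ξ_r-dimensional lower quantization coefficient of μ of order r is positive: liminf_{n→∞} n^{1/ξ_r} e_{n,r}(μ) > 0. -/

import Mathlib

open MeasureTheory Filter

/-- The `n`-th quantization error of order `r` of a Borel measure `P` on `ℝ^q`:
the infimum of `(∫ d(x,α)^r dP)^{1/r}` over finite sets `α` with `1 ≤ card α ≤ n`. -/
noncomputable def quantErr {q : ℕ} (P : Measure (EuclideanSpace ℝ (Fin q)))
    (n : ℕ) (r : ℝ) : ℝ :=
  sInf ((fun α : Finset (EuclideanSpace ℝ (Fin q)) =>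
      (∫ x, Metric.infDist x (α : Set (EuclideanSpace ℝ (Fin q))) ^ r ∂P) ^ (1 / r)) ''
    {α : Finset (EuclideanSpace ℝ (Fin q)) | α.Nonempty ∧ α.card ≤ n})

/-- Product of weights `g` along a word `σ` (equals `1` for the empty word). -/
noncomputable def prodw {N : ℕ} (g : Fin N → ℝ) (σ : List (Fin N)) : ℝ := (σ.map g).prod

/-- The composition `f_{σ_1} ∘ ⋯ ∘ f_{σ_n}` along a word `σ`. -/
def wordMap {q N : ℕ} (f : Fin N → EuclideanSpace ℝ (Fin q) → EuclideanSpace ℝ (Fin q))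
    (σ : List (Fin N)) : EuclideanSpace ℝ (Fin q) → EuclideanSpace ℝ (Fin q) :=
  σ.foldr (fun i g => f i ∘ g) id

/-- `h(σ) = h^{(1)}(σ) + h^{(2)}(σ)` where
`h^{(1)}(σ) = Σ_{j=0}^{|σ|-1} p0 p_{σ|_j} t_{σ^{(l)}_{-j}} s_σ^r` and `h^{(2)}(σ) = p_σ s_σ^r`. -/
noncomputable def hfun {N : ℕ} (r p0 : ℝ) (s t p : Fin N → ℝ) (σ : List (Fin N)) : ℝ :=
  (∑ j ∈ Finset.range σ.length, p0 * prodw p (σ.take j) * prodw t (σ.drop j)) * prodw s σ ^ r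
    + prodw p σ * prodw s σ ^ r

/-- `η̲_r := min_{1 ≤ i ≤ N} min{p0 t_i + p_i, t_i} · s_i^r`. -/
noncomputable def etaLow {N : ℕ} (r p0 : ℝ) (s t p : Fin N → ℝ) : ℝ :=
  ⨅ i, min (p0 * t i + p i) (t i) * s i ^ r

/-- The finite maximal antichain `Λ_{k,r} = {σ : h(σ|_{|σ|-1}) ≥ η̲_r/k > h(σ)}`. -/
def Lam {N : ℕ} (r p0 : ℝ) (s t p : Fin N → ℝ) (k : ℕ) : Set (List (Fin N)) :=
  {σ | σ ≠ [] ∧ etaLow r p0 s t p / k ≤ hfun r p0 s t p σ.dropLast ∧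
    hfun r p0 s t p σ < etaLow r p0 s t p / k}

/-- `a(x) = Σ_i (t_i s_i^r)^{x/(x+r)}` (also used for `b` with `p` in place of `t`). -/
noncomputable def afun {N : ℕ} (r : ℝ) (s t : Fin N → ℝ) (x : ℝ) : ℝ :=
  ∑ i, (t i * s i ^ r) ^ (x / (x + r))

section SelfSimilar

variable {q N : ℕ} {f : Fin N → EuclideanSpace ℝ (Fin q) → EuclideanSpace ℝ (Fin q)}
  {s : Fin N → ℝ} {E : Set (EuclideanSpace ℝ (Fin q))}

@[simp] lemma prodw_nil (g : Fin N → ℝ) : prodw g [] = 1 := by simp [prodw]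

@[simp] lemma prodw_cons (g : Fin N → ℝ) (i : Fin N) (σ : List (Fin N)) :
    prodw g (i :: σ) = g i * prodw g σ := by simp [prodw]

lemma prodw_append (g : Fin N → ℝ) (σ τ : List (Fin N)) :
    prodw g (σ ++ τ) = prodw g σ * prodw g τ := by simp [prodw]

lemma prodw_pos {g : Fin N → ℝ} (hg : ∀ i, 0 < g i) (σ : List (Fin N)) : 0 < prodw g σ := by
  induction σ with
  | nil => simp
  | cons i σ ih => simpa using mul_pos (hg i) ih

lemma prodw_le_pow {g : Fin N → ℝ} (hg : ∀ i, 0 < g i) {a : ℝ} (ha : 0 ≤ a)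
    (hga : ∀ i, g i ≤ a) (σ : List (Fin N)) : prodw g σ ≤ a ^ σ.length := by
  induction σ with
  | nil => simp
  | cons i σ ih =>
    simpa [pow_succ'] using mul_le_mul (hga i) ih (prodw_pos hg σ).le ha

lemma prodw_le_one {g : Fin N → ℝ} (hg : ∀ i, g i ∈ Set.Ioo (0 : ℝ) 1) (σ : List (Fin N)) :
    prodw g σ ≤ 1 := by
  simpa using prodw_le_pow (fun i => (hg i).1) zero_le_one (fun i => (hg i).2.le) σ

lemma prodw_le_of_prefix {g : Fin N → ℝ} (hg : ∀ i, g i ∈ Set.Ioo (0 : ℝ) 1)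
    {σ τ : List (Fin N)} (h : σ <+: τ) : prodw g τ ≤ prodw g σ := by
  obtain ⟨m, rfl⟩ := h
  rw [prodw_append]
  exact mul_le_of_le_one_right (prodw_pos (fun i => (hg i).1) σ).le (prodw_le_one hg m)

lemma prodw_mul_rpow {c s : Fin N → ℝ} (hs : ∀ i, 0 < s i) (r : ℝ) (σ : List (Fin N)) :
    prodw (fun i => c i * s i ^ r) σ = prodw c σ * prodw s σ ^ r := by
  induction σ with
  | nil => simp
  | cons i σ ih =>
    rw [prodw_cons, prodw_cons, prodw_cons, ih, Real.mul_rpow (hs i).le (prodw_pos hs σ).le]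
    ring

lemma prodw_rpow {g : Fin N → ℝ} (hg : ∀ i, 0 < g i) (κ : ℝ) (σ : List (Fin N)) :
    prodw (fun i => g i ^ κ) σ = prodw g σ ^ κ := by
  induction σ with
  | nil => simp
  | cons i σ ih => rw [prodw_cons, prodw_cons, ih, Real.mul_rpow (hg i).le (prodw_pos hg σ).le]

lemma exists_uniform_upper_bound {g : Fin N → ℝ} (hg : ∀ i, g i < 1) :
    ∃ a : ℝ, 0 < a ∧ a < 1 ∧ ∀ i, g i ≤ a := by
  rcases isEmpty_or_nonempty (Fin N) with h | h
  · exact ⟨1 / 2, by norm_num, by norm_num, fun i => h.elim i⟩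
  · obtain ⟨i, hi⟩ := Finite.exists_max g
    exact ⟨max (1 / 2) (g i), by positivity, max_lt (by norm_num) (hg i),
      fun j => (hi j).trans (le_max_right _ _)⟩

lemma exists_uniform_lower_bound {g : Fin N → ℝ} (hg : ∀ i, 0 < g i) :
    ∃ a : ℝ, 0 < a ∧ ∀ i, a ≤ g i := by
  rcases isEmpty_or_nonempty (Fin N) with h | h
  · exact ⟨1, by norm_num, fun i => h.elim i⟩
  · obtain ⟨i, hi⟩ := Finite.exists_min g
    exact ⟨g i, hg i, hi⟩

/-- A word whose weight is at most `b < 1` has a prefix at which the weight first drops to `b`. -/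
lemma exists_stopping_prefix {g : Fin N → ℝ} {b : ℝ} (hb : b < 1) {w : List (Fin N)}
    (hw : prodw g w ≤ b) :
    ∃ j, j <+: w ∧ j ≠ [] ∧ prodw g j ≤ b ∧ b < prodw g j.dropLast := by
  induction w using List.reverseRecOn with
  | nil => simp at hw; linarith
  | append_singleton v a ih =>
    by_cases hv : prodw g v ≤ b
    · obtain ⟨j, h1, h2⟩ := ih hv
      exact ⟨j, h1.trans (List.prefix_append _ _), h2⟩
    · exact ⟨v ++ [a], List.prefix_rfl, by simp, hw, by simpa using hv⟩

@[simp] lemma wordMap_cons (i : Fin N) (σ : List (Fin N)) (x : EuclideanSpace ℝ (Fin q)) :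
    wordMap f (i :: σ) x = f i (wordMap f σ x) := rfl

@[simp] lemma wordMap_nil (x : EuclideanSpace ℝ (Fin q)) : wordMap f [] x = x := rfl

lemma wordMap_append (σ τ : List (Fin N)) (x : EuclideanSpace ℝ (Fin q)) :
    wordMap f (σ ++ τ) x = wordMap f σ (wordMap f τ x) := by
  induction σ with
  | nil => rfl
  | cons i σ ih => simp [ih]

lemma dist_wordMap (hf : ∀ i x y, dist (f i x) (f i y) = s i * dist x y)
    (σ : List (Fin N)) (x y : EuclideanSpace ℝ (Fin q)) :
    dist (wordMap f σ x) (wordMap f σ y) = prodw s σ * dist x y := by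
  induction σ with
  | nil => simp
  | cons i σ ih => simp [hf, ih, mul_assoc]

lemma wordMap_mem (hEss : E = ⋃ i, f i '' E) (σ : List (Fin N)) {x : EuclideanSpace ℝ (Fin q)}
    (hx : x ∈ E) : wordMap f σ x ∈ E := by
  induction σ with
  | nil => exact hx
  | cons i σ ih =>
    rw [hEss]
    exact Set.mem_iUnion.2 ⟨i, _, ih, rfl⟩

lemma exists_wordMap_eq_of_length (hEss : E = ⋃ i, f i '' E) (m : ℕ) :
    ∀ x ∈ E, ∃ σ : List (Fin N), σ.length = m ∧ ∃ z ∈ E, wordMap f σ z = x := by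
  induction m with
  | zero => exact fun x hx => ⟨[], rfl, x, hx, rfl⟩
  | succ m ih =>
    intro x hx
    rw [hEss] at hx
    obtain ⟨i, y, hy, rfl⟩ := Set.mem_iUnion.1 hx
    obtain ⟨σ, hσ, z, hz, rfl⟩ := ih y hy
    exact ⟨i :: σ, by simp [hσ], z, hz, rfl⟩

lemma exists_wordMap_eq_of_small (hs : ∀ i, s i ∈ Set.Ioo (0 : ℝ) 1)
    (hEss : E = ⋃ i, f i '' E) {x : EuclideanSpace ℝ (Fin q)} (hx : x ∈ E) {ε : ℝ} (hε : 0 < ε) :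
    ∃ σ : List (Fin N), prodw s σ < ε ∧ ∃ z ∈ E, wordMap f σ z = x := by
  obtain ⟨a, ha0, ha1, ha⟩ := exists_uniform_upper_bound (fun i => (hs i).2)
  obtain ⟨m, hm⟩ := exists_pow_lt_of_lt_one hε ha1
  obtain ⟨σ, hσ, hz⟩ := exists_wordMap_eq_of_length hEss m x hx
  refine ⟨σ, lt_of_le_of_lt ?_ hm, hz⟩
  rw [← hσ]
  exact prodw_le_pow (fun i => (hs i).1) ha0.le ha σ

lemma surjective_of_dist_eq_mul {g : EuclideanSpace ℝ (Fin q) → EuclideanSpace ℝ (Fin q)} {c : ℝ}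
    (hc : 0 < c) (hg : ∀ x y, dist (g x) (g y) = c * dist x y) : Function.Surjective g := by
  have hiso : Isometry fun x => c⁻¹ • g x := by
    refine Isometry.of_dist_eq fun x y => ?_
    rw [dist_smul₀, hg, Real.norm_eq_abs, abs_of_pos (inv_pos.2 hc)]
    field_simp
  have hlin : Function.Surjective hiso.affineIsometryOfStrictConvexSpace.toAffineMap.linear :=
    LinearMap.injective_iff_surjective.1
      hiso.affineIsometryOfStrictConvexSpace.linearIsometry.injective
  have hsurj := AffineMap.linear_surjective_iff _ |>.1 hlin
  intro y
  obtain ⟨x, hx⟩ := hsurj (c⁻¹ • y)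
  refine ⟨x, smul_right_injective _ (inv_ne_zero hc.ne') ?_⟩
  simpa using hx

lemma surjective_wordMap (hs : ∀ i, s i ∈ Set.Ioo (0 : ℝ) 1)
    (hf : ∀ i x y, dist (f i x) (f i y) = s i * dist x y) (σ : List (Fin N)) :
    Function.Surjective (wordMap f σ) :=
  surjective_of_dist_eq_mul (prodw_pos (fun i => (hs i).1) σ) (dist_wordMap hf σ)

/-- Scale-invariant packing bound: a ball of radius `R * ρ` contains boundedly many points with
mutual distances at least `δ * ρ`. -/
lemma exists_packing_bound (R : ℝ) {δ : ℝ} (hδ : 0 < δ) :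
    ∃ M : ℕ, ∀ (ι : Type) (S : Finset ι) (a : ι → EuclideanSpace ℝ (Fin q))
      (y : EuclideanSpace ℝ (Fin q)) (ρ : ℝ), 0 < ρ → (∀ i ∈ S, dist (a i) y ≤ R * ρ) →
      (∀ i ∈ S, ∀ j ∈ S, i ≠ j → δ * ρ ≤ dist (a i) (a j)) → S.card ≤ M := by
  obtain ⟨T, -, hT, hcov⟩ :=
    (isCompact_closedBall (0 : EuclideanSpace ℝ (Fin q)) R).finite_cover_balls (half_pos hδ)
  refine ⟨hT.toFinset.card, fun ι S a y ρ hρ hball hsep => ?_⟩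
  have hex : ∀ i ∈ S, ∃ c ∈ T, dist (ρ⁻¹ • (a i - y)) c < δ / 2 := by
    intro i hi
    have : ρ⁻¹ • (a i - y) ∈ Metric.closedBall (0 : EuclideanSpace ℝ (Fin q)) R := by
      rw [mem_closedBall_zero_iff, norm_smul, Real.norm_eq_abs, abs_of_pos (inv_pos.2 hρ),
        ← dist_eq_norm, inv_mul_le_iff₀ hρ, mul_comm]
      exact hball i hi
    simpa using hcov this
  choose! c hcT hc using hex
  refine Finset.card_le_card_of_injOn c (fun i hi => by simpa using hcT i hi) ?_
  intro i hi j hj hij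
  by_contra hne
  have h1 := hc i hi
  have h2 := hc j hj
  rw [hij] at h1
  have h3 := dist_triangle_right (ρ⁻¹ • (a i - y)) (ρ⁻¹ • (a j - y)) (c j)
  have h4 : dist (ρ⁻¹ • (a i - y)) (ρ⁻¹ • (a j - y)) = ρ⁻¹ * dist (a i) (a j) := by
    rw [dist_smul₀, dist_sub_right, Real.norm_eq_abs, abs_of_pos (inv_pos.2 hρ)]
  have h5 := hsep i hi j hj hne
  have h6 : δ ≤ ρ⁻¹ * dist (a i) (a j) := by
    rw [le_inv_mul_iff₀ hρ, mul_comm]; exact h5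
  linarith

lemma wordMap_mem_of_invariant {U : Set (EuclideanSpace ℝ (Fin q))} (hU : ∀ i, f i '' U ⊆ U)
    (σ : List (Fin N)) {x : EuclideanSpace ℝ (Fin q)} (hx : x ∈ U) : wordMap f σ x ∈ U := by
  induction σ with
  | nil => exact hx
  | cons i σ ih => exact hU i ⟨_, ih, rfl⟩

lemma wordMap_ne_of_incomparable (hs : ∀ i, s i ∈ Set.Ioo (0 : ℝ) 1)
    (hf : ∀ i x y, dist (f i x) (f i y) = s i * dist x y)
    {U : Set (EuclideanSpace ℝ (Fin q))} (hU : ∀ i, f i '' U ⊆ U)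
    (hdisj : Pairwise fun i j => Disjoint (f i '' U) (f j '' U))
    {x y : EuclideanSpace ℝ (Fin q)} (hx : x ∈ U) (hy : y ∈ U) :
    ∀ {σ τ : List (Fin N)}, ¬ σ <+: τ → ¬ τ <+: σ → wordMap f σ x ≠ wordMap f τ y
  | [], _, h, _ => (h List.nil_prefix).elim
  | _ :: _, [], _, h => (h List.nil_prefix).elim
  | i :: σ, j :: τ, h1, h2 => by
    rw [List.cons_prefix_cons] at h1 h2
    rw [wordMap_cons, wordMap_cons]
    intro heq
    by_cases hij : i = j
    · subst hij
      refine wordMap_ne_of_incomparable hs hf hU hdisj hx hy (σ := σ) (τ := τ)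
        (by tauto) (by tauto) ?_
      have := hf i (wordMap f σ x) (wordMap f τ y)
      rw [heq, dist_self] at this
      rcases mul_eq_zero.1 this.symm with h | h
      · exact absurd h (hs i).1.ne'
      · exact dist_eq_zero.1 h
    · exact Set.disjoint_left.1 (hdisj hij) ⟨_, wordMap_mem_of_invariant hU σ hx, rfl⟩
        ⟨_, wordMap_mem_of_invariant hU τ hy, heq.symm⟩

lemma exists_separated_point (hs : ∀ i, s i ∈ Set.Ioo (0 : ℝ) 1)
    (hf : ∀ i x y, dist (f i x) (f i y) = s i * dist x y)
    (hOSC : ∃ U : Set (EuclideanSpace ℝ (Fin q)), U.Nonempty ∧ IsOpen U ∧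
      (∀ i, f i '' U ⊆ U) ∧ Pairwise fun i j => Disjoint (f i '' U) (f j '' U)) :
    ∃ u : EuclideanSpace ℝ (Fin q), ∃ δ > 0, ∀ σ τ : List (Fin N), ¬ σ <+: τ → ¬ τ <+: σ →
      δ * prodw s σ ≤ dist (wordMap f σ u) (wordMap f τ u) := by
  obtain ⟨U, ⟨u, hu⟩, hUo, hU, hdisj⟩ := hOSC
  obtain ⟨δ, hδ, hball⟩ := Metric.isOpen_iff.1 hUo u hu
  refine ⟨u, δ, hδ, fun σ τ h1 h2 => ?_⟩
  by_contra! hlt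
  obtain ⟨v, hv⟩ := surjective_wordMap hs hf σ (wordMap f τ u)
  refine wordMap_ne_of_incomparable hs hf hU hdisj (hball ?_) hu h1 h2 hv
  rw [← hv, dist_wordMap hf, mul_comm] at hlt
  rw [Metric.mem_ball, dist_comm]
  exact lt_of_mul_lt_mul_right hlt (prodw_pos (fun i => (hs i).1) σ).le

/-- The words `j` of size comparable to `k` whose cylinder comes close to that of `k`. -/
def neighborWords (f : Fin N → EuclideanSpace ℝ (Fin q) → EuclideanSpace ℝ (Fin q))
    (s : Fin N → ℝ) (E : Set (EuclideanSpace ℝ (Fin q))) (k : List (Fin N)) :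
    Set (List (Fin N)) :=
  {j | j ≠ [] ∧ prodw s j ≤ prodw s k ∧ prodw s k < prodw s j.dropLast ∧
    ∃ x ∈ E, ∃ y ∈ E, dist (wordMap f j x) (wordMap f k y) < prodw s k}

lemma not_prefix_of_mem_neighborWords (hs : ∀ i, s i ∈ Set.Ioo (0 : ℝ) 1)
    {k σ τ : List (Fin N)} (hσ : σ ∈ neighborWords f s E k) (hτ : τ ∈ neighborWords f s E k)
    (hne : σ ≠ τ) : ¬ σ <+: τ := by
  intro h
  obtain ⟨-, h1, -, -⟩ := hσ
  obtain ⟨hτ0, -, h2, -⟩ := hτ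
  have : σ <+: τ.dropLast := by
    rw [← List.dropLast_append_getLast hτ0, List.prefix_concat_iff] at h
    rcases h with h | h
    · rw [List.dropLast_append_getLast] at h
      exact (hne h).elim
    · exact h
  linarith [prodw_le_of_prefix hs this]

lemma exists_neighborWords_bound (hs : ∀ i, s i ∈ Set.Ioo (0 : ℝ) 1)
    (hf : ∀ i x y, dist (f i x) (f i y) = s i * dist x y) (hEcpt : IsCompact E)
    (hOSC : ∃ U : Set (EuclideanSpace ℝ (Fin q)), U.Nonempty ∧ IsOpen U ∧
      (∀ i, f i '' U ⊆ U) ∧ Pairwise fun i j => Disjoint (f i '' U) (f j '' U)) :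
    ∃ M : ℕ, ∀ k, (neighborWords f s E k).Finite ∧ (neighborWords f s E k).ncard ≤ M := by
  obtain ⟨u, δ, hδ, hsep⟩ := exists_separated_point hs hf hOSC
  obtain ⟨D, hD⟩ := hEcpt.isBounded.subset_closedBall u
  obtain ⟨a, ha0, ha⟩ := exists_uniform_lower_bound (fun i => (hs i).1)
  have hpos := prodw_pos (fun i => (hs i).1)
  obtain ⟨M, hM⟩ := exists_packing_bound (q := q) (2 * D + 1) (mul_pos hδ ha0)
  have key : ∀ k, ∀ S : Finset (List (Fin N)), (S : Set (List (Fin N))) ⊆ neighborWords f s E k →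
      S.card ≤ M := by
    intro k S hS
    refine hM _ S (fun j => wordMap f j u) (wordMap f k u) (prodw s k) (hpos k) ?_ ?_
    · intro j hj
      obtain ⟨-, hjk, -, x, hx, y, hy, hxy⟩ := hS hj
      have hx' := Metric.mem_closedBall'.1 (hD hx)
      have hy' := Metric.mem_closedBall.1 (hD hy)
      have h1 := dist_wordMap hf j u x
      have h2 := dist_wordMap hf k y u
      have h3 := dist_triangle4 (wordMap f j u) (wordMap f j x) (wordMap f k y) (wordMap f k u)
      have h4 : prodw s j * dist u x ≤ prodw s k * D :=
        mul_le_mul hjk hx' dist_nonneg (hpos k).le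
      have h5 : prodw s k * dist y u ≤ prodw s k * D :=
        mul_le_mul_of_nonneg_left hy' (hpos k).le
      change dist (wordMap f j u) (wordMap f k u) ≤ _
      linarith
    · intro i hi j hj hij
      refine le_trans ?_ (hsep i j (not_prefix_of_mem_neighborWords hs (hS hi) (hS hj) hij)
        (not_prefix_of_mem_neighborWords hs (hS hj) (hS hi) hij.symm))
      rw [mul_assoc]
      refine mul_le_mul_of_nonneg_left ?_ hδ.le
      obtain ⟨hi0, -, hik, -⟩ := hS hi
      rw [← List.dropLast_append_getLast hi0, prodw_append, prodw_cons, prodw_nil, mul_one,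
        mul_comm]
      exact mul_le_mul hik.le (ha _) ha0.le (hpos _).le
  refine ⟨M, fun k => ?_⟩
  have hfin : (neighborWords f s E k).Finite := by
    by_contra hinf
    obtain ⟨S, hS, hcard⟩ := Set.Infinite.exists_subset_card_eq hinf (M + 1)
    have := key k S hS
    omega
  refine ⟨hfin, ?_⟩
  rw [Set.ncard_eq_toFinset_card _ hfin]
  exact key k _ (by simp)

/-- Schief's argument: under the open set condition there is a point of the attractor with a ball
around it whose images along incomparable words are separated. -/
lemma exists_strongly_separated_point (hs : ∀ i, s i ∈ Set.Ioo (0 : ℝ) 1)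
    (hf : ∀ i x y, dist (f i x) (f i y) = s i * dist x y) (hEcpt : IsCompact E)
    (hEne : E.Nonempty) (hEss : E = ⋃ i, f i '' E)
    (hOSC : ∃ U : Set (EuclideanSpace ℝ (Fin q)), U.Nonempty ∧ IsOpen U ∧
      (∀ i, f i '' U ⊆ U) ∧ Pairwise fun i j => Disjoint (f i '' U) (f j '' U)) :
    ∃ x₀ ∈ E, ∃ ρ > 0, ∀ σ τ : List (Fin N), ¬ σ <+: τ → ¬ τ <+: σ →
      2 * ρ * prodw s σ ≤ dist (wordMap f σ x₀) (wordMap f τ x₀) := by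
  have hpos := prodw_pos (fun i => (hs i).1)
  obtain ⟨M, hM⟩ := exists_neighborWords_bound hs hf hEcpt hOSC
  obtain ⟨k, hk⟩ : ∃ k, ∀ k', (neighborWords f s E k').ncard ≤ (neighborWords f s E k).ncard := by
    have hbdd : BddAbove (Set.range fun k => (neighborWords f s E k).ncard) :=
      ⟨M, by rintro _ ⟨k, rfl⟩; exact (hM k).2⟩
    obtain ⟨k, hk⟩ := Nat.sSup_mem (Set.range_nonempty _) hbdd
    exact ⟨k, fun k' => (le_csSup hbdd ⟨k', rfl⟩).trans_eq hk.symm⟩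
  obtain ⟨y₀, hy₀⟩ := hEne
  refine ⟨wordMap f k y₀, wordMap_mem hEss k hy₀, prodw s k / 2, half_pos (hpos k), ?_⟩
  intro σ τ h1 h2
  have himage : (fun j => σ ++ j) '' neighborWords f s E k = neighborWords f s E (σ ++ k) := by
    refine Set.eq_of_subset_of_ncard_le ?_ ?_ (hM _).1
    · rintro _ ⟨j, ⟨hj0, hj1, hj2, x, hx, y, hy, hxy⟩, rfl⟩
      refine ⟨by simp [hj0], ?_, ?_, x, hx, y, hy, ?_⟩
      · simpa [prodw_append] using mul_le_mul_of_nonneg_left hj1 (hpos σ).le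
      · simpa [prodw_append, List.dropLast_append_of_ne_nil hj0] using
          mul_lt_mul_of_pos_left hj2 (hpos σ)
      · simpa [prodw_append, wordMap_append, dist_wordMap hf] using
          mul_lt_mul_of_pos_left hxy (hpos σ)
    · rw [Set.ncard_image_of_injective _ (List.append_right_injective σ)]
      exact hk _
  by_contra! hlt
  rw [dist_comm, ← wordMap_append σ k] at hlt
  have hlt1 : prodw s (σ ++ k) < 1 := by
    rw [prodw_append]
    refine lt_of_le_of_lt (mul_le_of_le_one_right (hpos σ).le (prodw_le_one hs k)) ?_
    cases σ with
    | nil => exact (h1 List.nil_prefix).elim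
    | cons i σ =>
      rw [prodw_cons]
      exact lt_of_le_of_lt (mul_le_of_le_one_right (hs i).1.le (prodw_le_one hs σ)) (hs i).2
  obtain ⟨m, hm, z, hz, hzx⟩ :=
    exists_wordMap_eq_of_small hs hEss (wordMap_mem hEss k hy₀) (hpos (σ ++ k))
  have hw : prodw s (τ ++ m) ≤ prodw s (σ ++ k) := by
    rw [prodw_append s τ]
    exact (mul_le_of_le_one_left (hpos m).le (prodw_le_one hs τ)).trans hm.le
  obtain ⟨j, ⟨j', hj'⟩, hj0, hj1, hj2⟩ := exists_stopping_prefix hlt1 hw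
  have hmem : j ∈ neighborWords f s E (σ ++ k) := by
    refine ⟨hj0, hj1, hj2, wordMap f j' z, wordMap_mem hEss j' hz, y₀, hy₀, ?_⟩
    rw [← wordMap_append, hj', wordMap_append, hzx]
    refine hlt.trans_le (le_of_eq ?_)
    rw [prodw_append]
    ring
  rw [← himage] at hmem
  obtain ⟨j'', -, rfl⟩ := hmem
  have hσ : σ <+: τ ++ m := ⟨j'' ++ j', by rw [← hj', List.append_assoc]⟩
  rcases List.prefix_or_prefix_of_prefix hσ (List.prefix_append τ m) with h | h
  · exact h1 h
  · exact h2 h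

variable {c : Fin N → ℝ} {P : Measure (EuclideanSpace ℝ (Fin q))}

lemma measurable_of_dist_eq_mul {g : EuclideanSpace ℝ (Fin q) → EuclideanSpace ℝ (Fin q)} {c : ℝ}
    (hc : 0 < c) (hg : ∀ x y, dist (g x) (g y) = c * dist x y) : Measurable g :=
  (LipschitzWith.of_dist_le_mul (K := ⟨c, hc.le⟩) fun x y => (hg x y).le).continuous.measurable

lemma measurable_wordMap (hs : ∀ i, s i ∈ Set.Ioo (0 : ℝ) 1)
    (hf : ∀ i x y, dist (f i x) (f i y) = s i * dist x y) (σ : List (Fin N)) :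
    Measurable (wordMap f σ) :=
  measurable_of_dist_eq_mul (prodw_pos (fun i => (hs i).1) σ) (dist_wordMap hf σ)

lemma sum_lintegral_comp_le (hs : ∀ i, s i ∈ Set.Ioo (0 : ℝ) 1)
    (hf : ∀ i x y, dist (f i x) (f i y) = s i * dist x y)
    (hP : ∑ i, ENNReal.ofReal (c i) • P.map (f i) ≤ P)
    {φ : EuclideanSpace ℝ (Fin q) → ENNReal} (hφ : Measurable φ) :
    ∑ i, ENNReal.ofReal (c i) * ∫⁻ x, φ (f i x) ∂P ≤ ∫⁻ x, φ x ∂P := by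
  refine le_trans (le_of_eq ?_) (lintegral_mono' hP le_rfl)
  rw [lintegral_finsetSum_measure]
  refine Finset.sum_congr rfl fun i _ => ?_
  rw [lintegral_smul_measure, lintegral_map hφ (measurable_of_dist_eq_mul (hs i).1 (hf i)),
    smul_eq_mul]

lemma mul_measure_preimage_wordMap_le (hs : ∀ i, s i ∈ Set.Ioo (0 : ℝ) 1)
    (hf : ∀ i x y, dist (f i x) (f i y) = s i * dist x y) (hc : ∀ i, 0 < c i)
    (hP : ∑ i, ENNReal.ofReal (c i) • P.map (f i) ≤ P) (σ : List (Fin N)) :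
    ∀ {A : Set (EuclideanSpace ℝ (Fin q))}, MeasurableSet A →
      ENNReal.ofReal (prodw c σ) * P (wordMap f σ ⁻¹' A) ≤ P A := by
  induction σ with
  | nil => intro A _; simp [Set.preimage]
  | cons i σ ih =>
    intro A hA
    have hfi := measurable_of_dist_eq_mul (hs i).1 (hf i)
    have h1 := ih (hfi hA)
    have h2 : ENNReal.ofReal (c i) * P (f i ⁻¹' A) ≤ P A := by
      refine le_trans ?_ (hP A)
      rw [Measure.finsetSum_apply]
      refine le_trans (le_of_eq ?_) (Finset.single_le_sum (fun _ _ => zero_le)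
        (Finset.mem_univ i))
      rw [Measure.smul_apply, Measure.map_apply hfi hA, smul_eq_mul]
    rw [prodw_cons, ENNReal.ofReal_mul (hc i).le, mul_assoc]
    exact (mul_le_mul_right h1 _).trans h2

/-- Every point of the attractor lies in the support of a measure dominating its own weighted
images. -/
lemma measure_ball_pos (hs : ∀ i, s i ∈ Set.Ioo (0 : ℝ) 1)
    (hf : ∀ i x y, dist (f i x) (f i y) = s i * dist x y) (hc : ∀ i, 0 < c i)
    (hP : ∑ i, ENNReal.ofReal (c i) • P.map (f i) ≤ P) (hP0 : P ≠ 0) (hEcpt : IsCompact E)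
    (hEss : E = ⋃ i, f i '' E) {x₀ : EuclideanSpace ℝ (Fin q)} (hx₀ : x₀ ∈ E)
    {ε : ℝ} (hε : 0 < ε) : 0 < P (Metric.ball x₀ ε) := by
  obtain ⟨n, hn⟩ : ∃ n : ℕ, P (Metric.ball x₀ n) ≠ 0 := by
    by_contra! h
    refine hP0 (Measure.measure_univ_eq_zero.1 ?_)
    rw [← Metric.iUnion_ball_nat x₀]
    exact measure_iUnion_null h
  obtain ⟨D, hD⟩ := hEcpt.isBounded.subset_closedBall x₀
  have hD0 : 0 ≤ D := dist_nonneg.trans (Metric.mem_closedBall.1 (hD hx₀))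
  have hR : 0 < n + D + 1 := by positivity
  obtain ⟨σ, hσ, z, hz, rfl⟩ := exists_wordMap_eq_of_small hs hEss hx₀ (div_pos hε hR)
  refine lt_of_lt_of_le ?_
    (mul_measure_preimage_wordMap_le hs hf hc hP σ Metric.isOpen_ball.measurableSet)
  refine ENNReal.mul_pos (ENNReal.ofReal_pos.2 (prodw_pos hc σ)).ne' fun h0 => hn ?_
  refine measure_mono_null (fun x hx => ?_) h0
  rw [Set.mem_preimage, Metric.mem_ball, dist_wordMap hf]
  have h1 := Metric.mem_ball.1 hx
  have h2 := Metric.mem_closedBall'.1 (hD hz)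
  have h3 := dist_triangle x (wordMap f σ z) z
  rw [lt_div_iff₀ hR] at hσ
  refine lt_of_le_of_lt (mul_le_mul_of_nonneg_left ?_ (prodw_pos (fun i => (hs i).1) σ).le) hσ
  linarith

/-- For every threshold `b` there is a maximal antichain of words whose weights are comparable
to `b`. -/
lemma exists_comparable_antichain (hs : ∀ i, s i ∈ Set.Ioo (0 : ℝ) 1)
    (hf : ∀ i x y, dist (f i x) (f i y) = s i * dist x y) (hc : ∀ i, 0 < c i)
    (hP : ∑ i, ENNReal.ofReal (c i) • P.map (f i) ≤ P) {w : Fin N → ℝ}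
    (hw : ∀ i, w i ∈ Set.Ioo (0 : ℝ) 1) (hw1 : ∑ i, w i = 1) {a A : ℝ} (ha0 : 0 < a)
    (ha : ∀ i, a ≤ w i) (hA : ∀ i, w i ≤ A) (m : ℕ) :
    ∀ b : ℝ, 0 < b → A ^ m ≤ b → ∃ Γ : Finset (List (Fin N)),
      (∀ σ ∈ Γ, ∀ τ ∈ Γ, σ <+: τ → σ = τ) ∧
      (∀ σ ∈ Γ, prodw w σ ≤ b ∧ min 1 (b * a) ≤ prodw w σ) ∧
      ∑ σ ∈ Γ, prodw w σ = 1 ∧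
      ∀ φ : EuclideanSpace ℝ (Fin q) → ENNReal, Measurable φ →
        ∑ σ ∈ Γ, ENNReal.ofReal (prodw c σ) * ∫⁻ x, φ (wordMap f σ x) ∂P ≤ ∫⁻ x, φ x ∂P := by
  have base : ∀ b : ℝ, 1 ≤ b → ∃ Γ : Finset (List (Fin N)),
      (∀ σ ∈ Γ, ∀ τ ∈ Γ, σ <+: τ → σ = τ) ∧
      (∀ σ ∈ Γ, prodw w σ ≤ b ∧ min 1 (b * a) ≤ prodw w σ) ∧
      ∑ σ ∈ Γ, prodw w σ = 1 ∧
      ∀ φ : EuclideanSpace ℝ (Fin q) → ENNReal, Measurable φ →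
        ∑ σ ∈ Γ, ENNReal.ofReal (prodw c σ) * ∫⁻ x, φ (wordMap f σ x) ∂P ≤ ∫⁻ x, φ x ∂P := by
    intro b hb
    exact ⟨{[]}, by simp, by simp [hb], by simp, by simp⟩
  induction m with
  | zero => intro b _ hb; exact base b (by simpa using hb)
  | succ m ih =>
    intro b hb hAb
    rcases le_or_gt 1 b with h1 | h1
    · exact base b h1
    have hstep : ∀ i, A ^ m ≤ b / w i := by
      intro i
      have hA0 : 0 < A := (hw i).1.trans_le (hA i)
      rw [le_div_iff₀ (hw i).1]
      refine le_trans ?_ hAb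
      rw [pow_succ]
      exact mul_le_mul_of_nonneg_left (hA i) (pow_pos hA0 m).le
    choose Γ hanti hbd hsum hint using fun i => ih (b / w i) (div_pos hb (hw i).1) (hstep i)
    have hinj : Function.Injective fun y : (_ : Fin N) × List (Fin N) => y.1 :: y.2 := by
      rintro ⟨i, σ⟩ ⟨j, τ⟩ h
      simp only [List.cons.injEq] at h
      obtain ⟨rfl, rfl⟩ := h
      rfl
    refine ⟨(Finset.univ.sigma Γ).map ⟨_, hinj⟩, ?_, ?_, ?_, ?_⟩
    · intro σ hσ τ hτ hpre
      simp only [Finset.mem_map, Finset.mem_sigma, Finset.mem_univ, true_and,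
        Function.Embedding.coeFn_mk, Sigma.exists] at hσ hτ
      obtain ⟨i, σ, hσ, rfl⟩ := hσ
      obtain ⟨j, τ, hτ, rfl⟩ := hτ
      obtain ⟨rfl, h⟩ := List.cons_prefix_cons.1 hpre
      rw [hanti i σ hσ τ hτ h]
    · intro σ hσ
      simp only [Finset.mem_map, Finset.mem_sigma, Finset.mem_univ, true_and,
        Function.Embedding.coeFn_mk, Sigma.exists] at hσ
      obtain ⟨i, σ, hσ, rfl⟩ := hσ
      obtain ⟨hu, hl⟩ := hbd i σ hσ
      have hwi := (hw i).1
      rw [prodw_cons]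
      refine ⟨by rwa [mul_comm, ← le_div_iff₀ hwi], ?_⟩
      refine (min_le_right _ _).trans ?_
      refine le_trans ?_ (mul_le_mul_of_nonneg_left hl hwi.le)
      rw [mul_min_of_nonneg _ _ hwi.le]
      refine le_min ?_ (le_of_eq ?_)
      · rw [mul_one]
        exact (mul_le_of_le_one_left ha0.le h1.le).trans (ha i)
      · field_simp
    · rw [Finset.sum_map, Finset.sum_sigma]
      simp only [Function.Embedding.coeFn_mk, prodw_cons, ← Finset.mul_sum, hsum, mul_one, hw1]
    · intro φ hφ
      rw [Finset.sum_map, Finset.sum_sigma]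
      refine le_trans (Finset.sum_le_sum fun i _ => ?_) (sum_lintegral_comp_le hs hf hP hφ)
      have hfi := measurable_of_dist_eq_mul (hs i).1 (hf i)
      refine le_trans (le_of_eq ?_) (mul_le_mul_right (hint i _ (hφ.comp hfi)) _)
      rw [Finset.mul_sum]
      refine Finset.sum_congr rfl fun σ _ => ?_
      simp only [Function.Embedding.coeFn_mk, prodw_cons, wordMap_cons, Function.comp_apply]
      rw [ENNReal.ofReal_mul (hc i).le, mul_assoc]

lemma card_filter_hit_le {x₀ : EuclideanSpace ℝ (Fin q)} {ρ : ℝ}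
    (hsep : ∀ σ τ : List (Fin N), ¬ σ <+: τ → ¬ τ <+: σ →
      2 * ρ * prodw s σ ≤ dist (wordMap f σ x₀) (wordMap f τ x₀))
    {Γ : Finset (List (Fin N))} (hanti : ∀ σ ∈ Γ, ∀ τ ∈ Γ, σ <+: τ → σ = τ)
    (α : Finset (EuclideanSpace ℝ (Fin q))) [DecidablePred fun σ : List (Fin N) =>
      ∃ y ∈ α, dist y (wordMap f σ x₀) < ρ * prodw s σ] :
    (Γ.filter fun σ => ∃ y ∈ α, dist y (wordMap f σ x₀) < ρ * prodw s σ).card ≤ α.card := by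
  have hex : ∀ σ ∈ Γ.filter fun σ => ∃ y ∈ α, dist y (wordMap f σ x₀) < ρ * prodw s σ,
      ∃ y ∈ α, dist y (wordMap f σ x₀) < ρ * prodw s σ := fun σ hσ => (Finset.mem_filter.1 hσ).2
  choose! y hyα hy using hex
  refine Finset.card_le_card_of_injOn y hyα ?_
  intro σ hσ τ hτ hστ
  by_contra hne
  have hσΓ := (Finset.mem_filter.1 hσ).1
  have hτΓ := (Finset.mem_filter.1 hτ).1
  have h1 := hsep σ τ (fun h => hne (hanti σ hσΓ τ hτΓ h))
    (fun h => hne (hanti τ hτΓ σ hσΓ h).symm)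
  have h2 := hsep τ σ (fun h => hne (hanti τ hτΓ σ hσΓ h).symm)
    (fun h => hne (hanti σ hσΓ τ hτΓ h))
  have h3 := hy σ hσ
  have h4 := hy τ hτ
  rw [← hστ] at h4
  have h5 := dist_triangle_left (wordMap f σ x₀) (wordMap f τ x₀) (y σ)
  rw [dist_comm (wordMap f τ x₀)] at h2
  rw [dist_comm] at h3 h4
  rw [dist_comm _ (y σ)] at h3 h4
  linarith

lemma lintegral_infDist_comp_ge (hs : ∀ i, s i ∈ Set.Ioo (0 : ℝ) 1)
    (hf : ∀ i x y, dist (f i x) (f i y) = s i * dist x y) {r : ℝ} (hr : 0 < r)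
    {x₀ : EuclideanSpace ℝ (Fin q)} {ρ : ℝ} (hρ : 0 < ρ)
    {α : Finset (EuclideanSpace ℝ (Fin q))} (hα : α.Nonempty) {σ : List (Fin N)}
    (hσ : ∀ y ∈ α, ρ * prodw s σ ≤ dist y (wordMap f σ x₀)) :
    ENNReal.ofReal ((ρ / 2 * prodw s σ) ^ r) * P (Metric.ball x₀ (ρ / 2)) ≤
      ∫⁻ x, ENNReal.ofReal (Metric.infDist (wordMap f σ x) (α : Set _) ^ r) ∂P := by
  have hpos := prodw_pos (fun i => (hs i).1) σ
  rw [← setLIntegral_const]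
  refine le_trans (setLIntegral_mono' Metric.isOpen_ball.measurableSet fun x hx => ?_)
    (setLIntegral_le_lintegral _ _)
  refine ENNReal.ofReal_le_ofReal (Real.rpow_le_rpow (by positivity) ?_ hr.le)
  refine (Metric.le_infDist (by simpa using hα)).2 fun y hy => ?_
  have h1 := hσ y hy
  have h2 := dist_wordMap hf σ x x₀
  have h3 := mul_lt_mul_of_pos_left (Metric.mem_ball.1 hx) hpos
  have h4 := dist_triangle_left y (wordMap f σ x₀) (wordMap f σ x)
  linarith

open Classical in
/-- A measure dominating the weighted sum of its images has quantization error of order at least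
`n ^ (-1 / ξ)`, where `ξ` is the exponent associated with the weights. -/
lemma exists_lintegral_infDist_lower_bound (hN : 2 ≤ N) {r : ℝ} (hr : 0 < r)
    (hs : ∀ i, s i ∈ Set.Ioo (0 : ℝ) 1)
    (hf : ∀ i x y, dist (f i x) (f i y) = s i * dist x y)
    (hEcpt : IsCompact E) (hEne : E.Nonempty) (hEss : E = ⋃ i, f i '' E)
    (hOSC : ∃ U : Set (EuclideanSpace ℝ (Fin q)), U.Nonempty ∧ IsOpen U ∧
      (∀ i, f i '' U ⊆ U) ∧ Pairwise fun i j => Disjoint (f i '' U) (f j '' U))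
    (hc : ∀ i, 0 < c i) [IsProbabilityMeasure P]
    (hP : ∑ i, ENNReal.ofReal (c i) • P.map (f i) ≤ P) {ξ : ℝ} (hξ : 0 < ξ)
    (hξe : ∑ i, (c i * s i ^ r) ^ (ξ / (ξ + r)) = 1) :
    ∃ C : ℝ, 0 < C ∧ ∀ n : ℕ, 1 ≤ n → ∀ α : Finset (EuclideanSpace ℝ (Fin q)), α.Nonempty →
      α.card ≤ n → ENNReal.ofReal (C * (n : ℝ) ^ (-(r / ξ))) ≤
        ∫⁻ x, ENNReal.ofReal (Metric.infDist x (α : Set _) ^ r) ∂P := by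
  obtain ⟨x₀, hx₀, ρ, hρ, hsep⟩ := exists_strongly_separated_point hs hf hEcpt hEne hEss hOSC
  have hβ : 0 < P.real (Metric.ball x₀ (ρ / 2)) :=
    ENNReal.toReal_pos (measure_ball_pos hs hf hc hP (IsProbabilityMeasure.ne_zero P) hEcpt hEss
      hx₀ (half_pos hρ)).ne' (measure_ne_top _ _)
  set β := P.real (Metric.ball x₀ (ρ / 2)) with hβdef
  have hspos := prodw_pos (fun i => (hs i).1)
  have hcs : ∀ i, 0 < c i * s i ^ r := fun i => mul_pos (hc i) (Real.rpow_pos_of_pos (hs i).1 r)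
  set w : Fin N → ℝ := fun i => (c i * s i ^ r) ^ (ξ / (ξ + r)) with hwdef
  have hwpos : ∀ i, 0 < w i := fun i => Real.rpow_pos_of_pos (hcs i) _
  have hw : ∀ i, w i ∈ Set.Ioo (0 : ℝ) 1 := by
    refine fun i => ⟨hwpos i, ?_⟩
    rw [← hξe]
    have : Nontrivial (Fin N) := Fin.nontrivial_iff_two_le.2 hN
    obtain ⟨j, hj⟩ := exists_ne i
    exact Finset.single_lt_sum hj (Finset.mem_univ i) (Finset.mem_univ j) (hwpos j)
      fun k _ _ => (hwpos k).le
  have hweight : ∀ σ, prodw c σ * prodw s σ ^ r = prodw w σ ^ (1 + r / ξ) := by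
    intro σ
    rw [← prodw_mul_rpow (fun i => (hs i).1), hwdef, prodw_rpow hcs,
      ← Real.rpow_mul (prodw_pos hcs σ).le]
    have : ξ / (ξ + r) * (1 + r / ξ) = 1 := by field_simp
    rw [this, Real.rpow_one]
  obtain ⟨a, ha0, ha⟩ := exists_uniform_lower_bound hwpos
  obtain ⟨A, hA0, hA1, hA⟩ := exists_uniform_upper_bound (fun i => (hw i).2)
  have ha1 : a ≤ 1 := (ha ⟨0, by omega⟩).trans (hw _).2.le
  refine ⟨(a / 2) ^ (1 + r / ξ) * (ρ / 2) ^ r * β, by positivity, ?_⟩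
  intro n hn α hα hcard
  have hn0 : (0 : ℝ) < n := by exact_mod_cast hn
  have hn1 : (1 : ℝ) ≤ n := by exact_mod_cast hn
  have hb : (0 : ℝ) < 1 / (2 * n) := by positivity
  obtain ⟨m, hm⟩ := exists_pow_lt_of_lt_one hb hA1
  obtain ⟨Γ, hanti, hbd, hsum, hint⟩ :=
    exists_comparable_antichain hs hf hc hP hw hξe ha0 ha hA m _ hb hm.le
  have hΓ : 2 * n ≤ Γ.card := by
    have h1 : (1 : ℝ) ≤ Γ.card * (1 / (2 * n)) := by
      rw [← nsmul_eq_mul]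
      refine hsum.symm.trans_le ?_
      exact Finset.sum_le_card_nsmul _ _ _ fun σ hσ => (hbd σ hσ).1
    rw [mul_one_div, le_div_iff₀ (by positivity), one_mul] at h1
    exact_mod_cast h1
  set G := Γ.filter fun σ => ¬ ∃ y ∈ α, dist y (wordMap f σ x₀) < ρ * prodw s σ with hG
  have hGcard : n ≤ G.card := by
    have h1 := card_filter_hit_le hsep hanti α
    have h2 : (Γ.filter fun σ => ∃ y ∈ α, dist y (wordMap f σ x₀) < ρ * prodw s σ).card + G.card
        = Γ.card := by
      rw [hG]
      convert Finset.card_filter_add_card_filter_not (s := Γ)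
        (fun σ => ∃ y ∈ α, dist y (wordMap f σ x₀) < ρ * prodw s σ)
    omega
  have hterm : ∀ σ ∈ G, ENNReal.ofReal ((a / (2 * n)) ^ (1 + r / ξ) * (ρ / 2) ^ r * β) ≤
      ENNReal.ofReal (prodw c σ) *
        ∫⁻ x, ENNReal.ofReal (Metric.infDist (wordMap f σ x) (α : Set _) ^ r) ∂P := by
    intro σ hσ
    obtain ⟨hσΓ, hσα⟩ := Finset.mem_filter.1 hσ
    push Not at hσα
    refine le_trans ?_ (mul_le_mul_right (lintegral_infDist_comp_ge hs hf hr hρ hα hσα) _)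
    rw [← ofReal_measureReal (μ := P) (s := Metric.ball x₀ (ρ / 2)), ← hβdef,
      ← ENNReal.ofReal_mul (Real.rpow_nonneg (mul_pos (half_pos hρ) (hspos σ)).le _),
      ← ENNReal.ofReal_mul (prodw_pos hc σ).le]
    refine ENNReal.ofReal_le_ofReal ?_
    rw [Real.mul_rpow (half_pos hρ).le (hspos σ).le]
    have h1 : a / (2 * n) ≤ prodw w σ := by
      refine le_trans (le_min ?_ (le_of_eq (by ring))) (hbd σ hσΓ).2
      rw [div_le_one (by positivity)]
      linarith
    have h2 : (a / (2 * n)) ^ (1 + r / ξ) ≤ prodw c σ * prodw s σ ^ r := by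
      rw [hweight]
      exact Real.rpow_le_rpow (by positivity) h1 (by positivity)
    have h3 : 0 ≤ (ρ / 2) ^ r * β := by positivity
    calc (a / (2 * n)) ^ (1 + r / ξ) * (ρ / 2) ^ r * β
        = (a / (2 * n)) ^ (1 + r / ξ) * ((ρ / 2) ^ r * β) := by ring
      _ ≤ (prodw c σ * prodw s σ ^ r) * ((ρ / 2) ^ r * β) := mul_le_mul_of_nonneg_right h2 h3
      _ = _ := by ring
  have hmeas : Measurable fun x : EuclideanSpace ℝ (Fin q) =>
      ENNReal.ofReal (Metric.infDist x (α : Set _) ^ r) :=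
    ENNReal.measurable_ofReal.comp
      ((Metric.continuous_infDist_pt _).measurable.pow_const r)
  calc ENNReal.ofReal ((a / 2) ^ (1 + r / ξ) * (ρ / 2) ^ r * β * (n : ℝ) ^ (-(r / ξ)))
      = n * ENNReal.ofReal ((a / (2 * n)) ^ (1 + r / ξ) * (ρ / 2) ^ r * β) := by
        rw [← ENNReal.ofReal_natCast, ← ENNReal.ofReal_mul hn0.le, ← div_div,
          Real.div_rpow (by positivity) hn0.le, Real.rpow_add hn0, Real.rpow_one,
          Real.rpow_neg hn0.le]
        congr 1
        field_simp
    _ ≤ G.card * ENNReal.ofReal ((a / (2 * n)) ^ (1 + r / ξ) * (ρ / 2) ^ r * β) := by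
        gcongr
    _ ≤ ∑ σ ∈ G, ENNReal.ofReal (prodw c σ) *
        ∫⁻ x, ENNReal.ofReal (Metric.infDist (wordMap f σ x) (α : Set _) ^ r) ∂P := by
        rw [← nsmul_eq_mul]
        exact Finset.card_nsmul_le_sum _ _ _ hterm
    _ ≤ ∑ σ ∈ Γ, ENNReal.ofReal (prodw c σ) *
        ∫⁻ x, ENNReal.ofReal (Metric.infDist (wordMap f σ x) (α : Set _) ^ r) ∂P :=
        Finset.sum_le_sum_of_subset (Finset.filter_subset _ _)
    _ ≤ _ := hint _ hmeas

lemma integrable_infDist_rpow [IsProbabilityMeasure P] (hPc : ∃ K, IsCompact K ∧ P Kᶜ = 0)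
    {r : ℝ} (hr : 0 < r) (α : Set (EuclideanSpace ℝ (Fin q))) :
    Integrable (fun x => Metric.infDist x α ^ r) P := by
  obtain ⟨K, hK, hKc⟩ := hPc
  have hcont : Continuous fun x : EuclideanSpace ℝ (Fin q) => Metric.infDist x α ^ r :=
    (Metric.continuous_infDist_pt α).rpow_const fun _ => Or.inr hr.le
  rw [← Measure.restrict_eq_self_of_ae_mem (s := K) (μ := P) (mem_ae_iff.2 hKc)]
  exact hcont.continuousOn.integrableOn_compact hK

lemma le_quantErr [IsProbabilityMeasure P] (hPc : ∃ K, IsCompact K ∧ P Kᶜ = 0)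
    {r : ℝ} (hr : 0 < r) {n : ℕ} (hn : 1 ≤ n) {B : ℝ} (hB : 0 ≤ B)
    (h : ∀ α : Finset (EuclideanSpace ℝ (Fin q)), α.Nonempty → α.card ≤ n →
      ENNReal.ofReal B ≤ ∫⁻ x, ENNReal.ofReal (Metric.infDist x (α : Set _) ^ r) ∂P) :
    B ^ (1 / r) ≤ quantErr P n r := by
  refine le_csInf (Set.Nonempty.image _ ⟨{0}, by simpa using hn⟩) ?_
  rintro _ ⟨α, ⟨hα, hcard⟩, rfl⟩
  have hnn : ∀ x, 0 ≤ Metric.infDist x (α : Set (EuclideanSpace ℝ (Fin q))) ^ r :=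
    fun x => Real.rpow_nonneg Metric.infDist_nonneg r
  refine Real.rpow_le_rpow hB ?_ (by positivity)
  have h1 := h α hα hcard
  rwa [← ofReal_integral_eq_lintegral_ofReal (integrable_infDist_rpow hPc hr _)
    (Filter.Eventually.of_forall hnn),
    ENNReal.ofReal_le_ofReal_iff (integral_nonneg hnn)] at h1

end SelfSimilar

/-- Theorem (Zhu): under the OSC, the `ξ_r`-dimensional lower quantization coefficient
of `μ` of order `r` is positive: `liminf_n n^{1/ξ_r} e_{n,r}(μ) > 0`. -/
theorem lower_quantization_coefficient_pos
    (q N : ℕ) (hq : 1 ≤ q) (hN : 2 ≤ N) (r : ℝ) (hr : 0 < r)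
    (f : Fin N → EuclideanSpace ℝ (Fin q) → EuclideanSpace ℝ (Fin q))
    (s : Fin N → ℝ) (hs : ∀ i, s i ∈ Set.Ioo (0 : ℝ) 1)
    (hf : ∀ i x y, dist (f i x) (f i y) = s i * dist x y)
    (E : Set (EuclideanSpace ℝ (Fin q)))
    (hEcpt : IsCompact E) (hEne : E.Nonempty) (hEss : E = ⋃ i, f i '' E)
    (hEdiam : Metric.diam E = 1)
    (hOSC : ∃ U : Set (EuclideanSpace ℝ (Fin q)), U.Nonempty ∧ IsOpen U ∧
      (∀ i, f i '' U ⊆ U) ∧ Pairwise fun i j => Disjoint (f i '' U) (f j '' U))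
    (t : Fin N → ℝ) (ht : ∀ i, 0 < t i) (ht1 : ∑ i, t i = 1)
    (ν : Measure (EuclideanSpace ℝ (Fin q))) (hνP : IsProbabilityMeasure ν)
    (hνc : ∃ K, IsCompact K ∧ ν Kᶜ = 0)
    (hνss : ν = ∑ i, ENNReal.ofReal (t i) • ν.map (f i))
    (p0 : ℝ) (p : Fin N → ℝ) (hp0 : 0 < p0) (hp : ∀ i, 0 < p i)
    (hp1 : p0 + ∑ i, p i = 1)
    (μ : Measure (EuclideanSpace ℝ (Fin q))) (hμP : IsProbabilityMeasure μ)
    (hμc : ∃ K, IsCompact K ∧ μ Kᶜ = 0)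
    (hμss : μ = ENNReal.ofReal p0 • ν + ∑ i, ENNReal.ofReal (p i) • μ.map (f i))
    (ξ1 ξ2 : ℝ) (hξ1 : 0 < ξ1) (hξ2 : 0 < ξ2)
    (hξ1e : ∑ i, (t i * s i ^ r) ^ (ξ1 / (ξ1 + r)) = 1)
    (hξ2e : ∑ i, (p i * s i ^ r) ^ (ξ2 / (ξ2 + r)) = 1)
    :
    0 < liminf (fun n : ℕ =>
      (((n : ℝ) ^ (1 / max ξ1 ξ2) * quantErr μ n r : ℝ) : EReal)) atTop := by
  have hν_le : ENNReal.ofReal p0 • ν ≤ μ := by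
    conv_rhs => rw [hμss]
    exact Measure.le_add_right le_rfl
  have hμ_le : ∑ i, ENNReal.ofReal (p i) • μ.map (f i) ≤ μ := by
    conv_rhs => rw [hμss]
    exact Measure.le_add_left le_rfl
  have hξ : 0 < max ξ1 ξ2 := lt_max_of_lt_left hξ1
  obtain ⟨C, hC, hbound⟩ : ∃ C : ℝ, 0 < C ∧ ∀ n : ℕ, 1 ≤ n →
      ∀ α : Finset (EuclideanSpace ℝ (Fin q)), α.Nonempty → α.card ≤ n →
        ENNReal.ofReal (C * (n : ℝ) ^ (-(r / max ξ1 ξ2))) ≤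
          ∫⁻ x, ENNReal.ofReal (Metric.infDist x (α : Set _) ^ r) ∂μ := by
    rcases le_total ξ1 ξ2 with h | h
    · rw [max_eq_right h]
      exact exists_lintegral_infDist_lower_bound hN hr hs hf hEcpt hEne hEss hOSC hp hμ_le hξ2 hξ2e
    · rw [max_eq_left h]
      obtain ⟨C, hC, hbound⟩ := exists_lintegral_infDist_lower_bound hN hr hs hf hEcpt hEne hEss
        hOSC ht hνss.ge hξ1 hξ1e
      refine ⟨p0 * C, mul_pos hp0 hC, fun n hn α hα hcard => ?_⟩
      refine le_trans ?_ (lintegral_mono' hν_le le_rfl)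
      rw [lintegral_smul_measure, smul_eq_mul, mul_assoc, ENNReal.ofReal_mul hp0.le]
      exact mul_le_mul_right (hbound n hn α hα hcard) _
  have hpos : (0 : EReal) < ((C ^ (1 / r) : ℝ) : EReal) :=
    EReal.coe_pos.2 (Real.rpow_pos_of_pos hC _)
  refine hpos.trans_le (le_liminf_of_le (by isBoundedDefault) ?_)
  filter_upwards [eventually_ge_atTop 1] with n hn
  have hn0 : (0 : ℝ) < n := by exact_mod_cast hn
  have herr := le_quantErr hμc hr hn (by positivity) (hbound n hn)
  refine EReal.coe_le_coe_iff.2 ?_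
  refine le_trans (le_of_eq ?_) (mul_le_mul_of_nonneg_left herr (by positivity))
  rw [Real.mul_rpow hC.le (by positivity), ← Real.rpow_mul hn0.le, mul_left_comm,
    ← Real.rpow_add hn0]
  have : 1 / max ξ1 ξ2 + -(r / max ξ1 ξ2) * (1 / r) = 0 := by field_simp; ring
  rw [this, Real.rpow_zero, mul_one]
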